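/- Let u be the non-simple Parry word associated with the substitution φ, let h′ = min{ℓ : m ≤ ℓ ≤ m+p−1, α_ℓ ≥ 1}, and let R_ns = h′ + p if α_0 ≥ 2 and R_ns = h′ + m + p − 1 if α_0 = 1. Then for every n ≥ 1 and every k ∈ ℕ with n ≤ F_k, the word φ^{k+R_ns}(0)·u_[n] is a prefix of u and every factor of u of length n is a factor of φ^{k+R_ns}(0)·u_[n]. -/

import Mathlib

/-- The prefix of length `n` of the infinite word `u`. -/
def pref (u : ℕ → ℕ) (n : ℕ) : List ℕ := (List.range n).map u

/-- `w` is a factor of the infinite word `u`. -/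
def IsFactor (u : ℕ → ℕ) (w : List ℕ) : Prop :=
  ∃ i : ℕ, w = (List.range w.length).map (fun j => u (i + j))

/-- The Parikh vector of `w`, viewed as a word over `{0, …, m-1}`. -/
def parikh (m : ℕ) (w : List ℕ) : Fin m → ℤ := fun ℓ => (w.count (ℓ : ℕ) : ℤ)

/-- The set of relative Parikh vectors of factors of `u` of length `n`. -/
def relParikhSet (m : ℕ) (u : ℕ → ℕ) (n : ℕ) : Set (Fin m → ℤ) :=
  { v | ∃ w : List ℕ, IsFactor u w ∧ w.length = n ∧ v = parikh m w - parikh m (pref u n) }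

/-- The extension of a substitution `φ` to finite words. -/
def substW (φ : ℕ → List ℕ) (w : List ℕ) : List ℕ := w.flatMap φ

/-- The `k`-th iterate of the substitution `φ`, applied to the word `w`. -/
def iterW (φ : ℕ → List ℕ) (k : ℕ) (w : List ℕ) : List ℕ := (substW φ)^[k] w

/-- The finite word `w` is a prefix of the infinite word `u`. -/
def IsPref (u : ℕ → ℕ) (w : List ℕ) : Prop := w = pref u w.length

lemma length_pref (u : ℕ → ℕ) (n : ℕ) : (pref u n).length = n := by simp [pref]

lemma pref_add (u : ℕ → ℕ) (a b : ℕ) :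
    pref u (a + b) = pref u a ++ (List.range b).map (fun j => u (a + j)) := by
  simp [pref, List.range_add, Function.comp_def]

lemma pref_prefix_pref (u : ℕ → ℕ) {a b : ℕ} (h : a ≤ b) : pref u a <+: pref u b := by
  obtain ⟨c, rfl⟩ := Nat.exists_eq_add_of_le h
  exact ⟨_, (pref_add u a c).symm⟩

lemma isPref_pref (u : ℕ → ℕ) (n : ℕ) : IsPref u (pref u n) := by
  rw [IsPref, length_pref]

lemma IsPref.prefix_of_length_le {u : ℕ → ℕ} {v w : List ℕ} (hv : IsPref u v) (hw : IsPref u w)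
    (h : v.length ≤ w.length) : v <+: w := by
  rw [hv, hw]
  exact pref_prefix_pref u h

lemma IsPref.of_prefix {u : ℕ → ℕ} {v w : List ℕ} (hw : IsPref u w) (h : v <+: w) :
    IsPref u v := by
  have h1 : pref u v.length <+: w := by
    rw [hw]; exact pref_prefix_pref u h.length_le
  have h2 := List.prefix_of_prefix_length_le h h1 (by rw [length_pref])
  exact h2.eq_of_length (by rw [length_pref])

lemma substW_append (φ : ℕ → List ℕ) (v w : List ℕ) :
    substW φ (v ++ w) = substW φ v ++ substW φ w := by
  simp [substW]

lemma iterW_succ (φ : ℕ → List ℕ) (k : ℕ) (w : List ℕ) :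
    iterW φ (k + 1) w = substW φ (iterW φ k w) := by
  simp [iterW, Function.iterate_succ_apply']

lemma iterW_one (φ : ℕ → List ℕ) (ℓ : ℕ) : iterW φ 1 [ℓ] = φ ℓ := by
  simp [iterW, substW]

lemma iterW_add (φ : ℕ → List ℕ) (j k : ℕ) (w : List ℕ) :
    iterW φ (j + k) w = iterW φ j (iterW φ k w) := by
  simp [iterW, Function.iterate_add_apply]

lemma iterW_append (φ : ℕ → List ℕ) (k : ℕ) (v w : List ℕ) :
    iterW φ k (v ++ w) = iterW φ k v ++ iterW φ k w := by
  induction k with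
  | zero => rfl
  | succ k ih => simp only [iterW_succ, ih, substW_append]

lemma iterW_prefix (φ : ℕ → List ℕ) (k : ℕ) {v w : List ℕ} (h : v <+: w) :
    iterW φ k v <+: iterW φ k w := by
  obtain ⟨t, rfl⟩ := h
  rw [iterW_append]
  exact List.prefix_append _ _

lemma iterW_suffix (φ : ℕ → List ℕ) (k : ℕ) {v w : List ℕ} (h : v <:+ w) :
    iterW φ k v <:+ iterW φ k w := by
  obtain ⟨t, rfl⟩ := h
  rw [iterW_append]
  exact List.suffix_append _ _

/-- A nonempty prefix of `φ(w)` ends inside the image of some letter of `w`. -/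
lemma exists_desubstitution (φ : ℕ → List ℕ) (w : List ℕ) {A : List ℕ} (hA : A ≠ [])
    (h : A <+: substW φ w) :
    ∃ D d E, D ++ [d] <+: w ∧ A = substW φ D ++ E ∧ E ≠ [] ∧ E <+: φ d := by
  induction w generalizing A with
  | nil => simp [substW] at h; exact absurd h hA
  | cons d w ih =>
    have h' : A <+: φ d ++ substW φ w := by simpa [substW] using h
    rcases List.prefix_or_prefix_of_prefix h' (List.prefix_append _ _) with h1 | ⟨B, rfl⟩
    · exact ⟨[], d, A, by simp, by simp [substW], hA, h1⟩
    · have hB := (List.prefix_append_right_inj _).1 h'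
      by_cases hB0 : B = []
      · subst hB0
        exact ⟨[], d, φ d, by simp, by simp [substW], by simpa using hA, List.prefix_rfl⟩
      · obtain ⟨D, e, E, h1, h2, h3, h4⟩ := ih hB0 hB
        exact ⟨d :: D, e, E, by simpa using h1, by simp [h2, substW], h3, h4⟩

/-- The successor of a letter under the substitution of a non-simple Parry word with
preperiod `m` and period `p`. -/
def nextLetter (m p ℓ : ℕ) : ℕ := if ℓ + 1 < m + p then ℓ + 1 else m

/-- `u` is an infinite word over `{0, …, m+p-1}` fixed by the substitution
`ℓ ↦ 0^{α ℓ} (nextLetter ℓ)`. -/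
structure IsParryWord (m p : ℕ) (α : ℕ → ℕ) (φ : ℕ → List ℕ) (u : ℕ → ℕ) : Prop where
  one_le_m : 1 ≤ m
  one_le_p : 1 ≤ p
  one_le_zero : 1 ≤ α 0
  le_zero : ∀ ℓ, ℓ < m + p → α ℓ ≤ α 0
  subst_eq : ∀ ℓ, ℓ < m + p → φ ℓ = List.replicate (α ℓ) 0 ++ [nextLetter m p ℓ]
  letter_lt : ∀ i, u i < m + p
  isPref_iterW : ∀ k, IsPref u (iterW φ k [0])

namespace IsParryWord

variable {m p : ℕ} {α : ℕ → ℕ} {φ : ℕ → List ℕ} {u : ℕ → ℕ}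

lemma nextLetter_ne_zero (H : IsParryWord m p α φ u) (ℓ : ℕ) : nextLetter m p ℓ ≠ 0 := by
  have := H.one_le_m
  unfold nextLetter
  split_ifs <;> omega

lemma subst_zero (H : IsParryWord m p α φ u) : ∃ y t, φ 0 = 0 :: y :: t ∧
    (2 ≤ α 0 → y = 0) ∧ (α 0 = 1 → y = 1) := by
  have h1 := H.one_le_m
  have h2 := H.one_le_p
  have h3 := H.one_le_zero
  rw [H.subst_eq 0 (by omega)]
  obtain ⟨a, ha⟩ : ∃ a, α 0 = a + 1 := ⟨α 0 - 1, by omega⟩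
  rw [ha]
  cases a with
  | zero =>
    exact ⟨1, [], by simp [nextLetter, show 1 < m + p by omega], by simp, by simp⟩
  | succ a => exact ⟨0, List.replicate a 0 ++ [nextLetter m p 0], by simp [List.replicate_succ]⟩

lemma subst_ne_nil (H : IsParryWord m p α φ u) {ℓ : ℕ} (hℓ : ℓ < m + p) : φ ℓ ≠ [] := by
  simp [H.subst_eq ℓ hℓ]

lemma mem_lt (H : IsParryWord m p α φ u) {w : List ℕ} (hw : IsPref u w) {x : ℕ} (hx : x ∈ w) :
    x < m + p := by
  rw [hw] at hx
  simp only [pref, List.mem_map] at hx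
  obtain ⟨i, -, rfl⟩ := hx
  exact H.letter_lt i

lemma length_le_length_substW (H : IsParryWord m p α φ u) {w : List ℕ}
    (hw : ∀ x ∈ w, x < m + p) : w.length ≤ (substW φ w).length := by
  induction w with
  | nil => simp
  | cons a w ih =>
    have h1 := List.length_pos_iff.2 (H.subst_ne_nil (hw a (by simp)))
    have h2 := ih fun x hx => hw x (by simp [hx])
    simp only [substW, List.flatMap_cons, List.length_append, List.length_cons] at h2 ⊢
    omega

lemma iterW_zero_prefix (H : IsParryWord m p α φ u) {j k : ℕ} (h : j ≤ k) :
    iterW φ j [0] <+: iterW φ k [0] := by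
  obtain ⟨y, t, ht, -⟩ := H.subst_zero
  induction k, h using Nat.le_induction with
  | base => exact List.prefix_rfl
  | succ k _ ih =>
    refine ih.trans ?_
    rw [iterW_add, iterW_one, ht]
    exact iterW_prefix φ k (by simp)

lemma zero_prefix_iterW (H : IsParryWord m p α φ u) (k : ℕ) : [0] <+: iterW φ k [0] :=
  H.iterW_zero_prefix (Nat.zero_le k)

lemma length_lt_length_substW (H : IsParryWord m p α φ u) {w : List ℕ} (hw : IsPref u w)
    (h0 : w ≠ []) : w.length < (substW φ w).length := by
  obtain ⟨y, t, ht, -⟩ := H.subst_zero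
  have hz : [0] <+: w := (H.isPref_iterW 0).prefix_of_length_le hw
    (List.length_pos_iff.2 h0)
  obtain ⟨v, rfl⟩ := hz
  have := H.length_le_length_substW (w := v) fun x hx => H.mem_lt hw (by simp [hx])
  rw [substW_append]
  simp [substW, ht] at this ⊢
  omega

lemma lt_length_iterW (H : IsParryWord m p α φ u) (k : ℕ) : k < (iterW φ k [0]).length := by
  induction k with
  | zero => simp [iterW]
  | succ k ih =>
    have h := H.length_lt_length_substW (H.isPref_iterW k) (List.length_pos_iff.1 (by omega))
    rw [iterW_succ]
    omega

lemma prefix_iterW (H : IsParryWord m p α φ u) {w : List ℕ} (hw : IsPref u w) :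
    w <+: iterW φ w.length [0] :=
  hw.prefix_of_length_le (H.isPref_iterW _) (H.lt_length_iterW _).le

lemma isPref_image (H : IsParryWord m p α φ u) {w : List ℕ} (hw : IsPref u w) (k : ℕ) :
    IsPref u (iterW φ k w) := by
  refine (H.isPref_iterW (k + w.length)).of_prefix ?_
  rw [iterW_add]
  exact iterW_prefix φ k (H.prefix_iterW hw)

lemma isPref_substW (H : IsParryWord m p α φ u) {w : List ℕ} (hw : IsPref u w) :
    IsPref u (substW φ w) := H.isPref_image hw 1

lemma iterW_letter_ne_nil (H : IsParryWord m p α φ u) (r : ℕ) {ℓ : ℕ} (hℓ : ℓ < m + p) :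
    iterW φ r [ℓ] ≠ [] := by
  have hp := H.one_le_p
  induction r generalizing ℓ with
  | zero => simp [iterW]
  | succ r ih =>
    have hn : nextLetter m p ℓ < m + p := by
      unfold nextLetter
      split_ifs <;> omega
    rw [iterW_add, iterW_one, H.subst_eq ℓ hℓ, iterW_append]
    simp [ih hn]

lemma desubstitution (H : IsParryWord m p α φ u) {A : List ℕ} (hA : A ≠ []) (h : IsPref u A) :
    ∃ D d E, IsPref u (D ++ [d]) ∧ A = substW φ D ++ E ∧ E ≠ [] ∧ E <+: φ d := by
  have h1 : A <+: substW φ (iterW φ A.length [0]) := by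
    rw [← iterW_succ]
    exact (H.prefix_iterW h).trans (H.iterW_zero_prefix (Nat.le_succ _))
  obtain ⟨D, d, E, hD, hE⟩ := exists_desubstitution φ _ hA h1
  exact ⟨D, d, E, (H.isPref_iterW _).of_prefix hD, hE⟩

/-- Every nonempty prefix of `u` is `φ^r` of a prefix ending in `0`. -/
lemma exists_ancestor (H : IsParryWord m p α φ u) {A : List ℕ} (hA : A ≠ []) (h : IsPref u A) :
    ∃ r B, IsPref u (B ++ [0]) ∧ A = iterW φ r (B ++ [0]) := by
  induction hn : A.length using Nat.strong_induction_on generalizing A with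
  | _ n ih =>
  subst hn
  obtain ⟨D, d, E, hD, rfl, hE0, hE⟩ := H.desubstitution hA h
  have hd : d < m + p := H.mem_lt hD (by simp)
  rw [H.subst_eq d hd, List.prefix_concat_iff] at hE
  rcases hE with rfl | hE
  · rw [← H.subst_eq d hd]
    have hDd : substW φ D ++ φ d = substW φ (D ++ [d]) := by simp [substW]
    obtain ⟨r, B, hB, hr⟩ := ih _
      (by rw [← H.subst_eq d hd, hDd]; exact H.length_lt_length_substW hD (by simp))
      (by simp) hD rfl
    exact ⟨r + 1, B, hB, by rw [hDd, hr, iterW_succ]⟩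
  · obtain ⟨e, he⟩ : ∃ e, E.length = e + 1 :=
      ⟨E.length - 1, by have := List.length_pos_iff.2 hE0; omega⟩
    rw [(List.prefix_replicate_iff.1 hE).2, he, List.replicate_succ', ← List.append_assoc] at h ⊢
    exact ⟨0, _, h, rfl⟩

/-- Inside `u`, a letter `0` and its right neighbour lie in the image of a single letter. -/
lemma exists_infix_subst (H : IsParryWord m p α φ u) {A : List ℕ} {z : ℕ}
    (h : IsPref u (A ++ [0, z])) : ∃ d, d < m + p ∧ [0, z] <:+: φ d := by
  have h0 : IsPref u (A ++ [0]) := h.of_prefix (by simp)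
  obtain ⟨D, d, E, hD, hAE, hE0, E', hE⟩ := H.desubstitution (by simp) h0
  have hd : d < m + p := H.mem_lt hD (by simp)
  refine ⟨d, hd, ?_⟩
  obtain ⟨E₁, e, rfl⟩ := List.eq_nil_or_concat E |>.resolve_left hE0
  rw [List.concat_eq_append, ← List.append_assoc] at hAE
  obtain ⟨rfl, he⟩ := List.append_inj' hAE rfl
  obtain rfl : e = 0 := by simpa using he.symm
  have hp : IsPref u (substW φ D ++ φ d) := by
    have := H.isPref_substW hD
    simpa [substW] using this
  cases E' with
  | nil =>
    rw [H.subst_eq d hd] at hE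
    have := congrArg List.getLast? hE
    simp at this
    exact absurd this.symm (H.nextLetter_ne_zero d)
  | cons y E' =>
    have h2 := h.prefix_of_length_le hp (by simp [← hE])
    rw [← hE] at h2 ⊢
    have hy : z = y := by simpa using h2
    subst hy
    exact ⟨E₁, E', by simp⟩

lemma suffix_iterW_succ (H : IsParryWord m p α φ u) {r x : ℕ} (hx : x < m + p)
    (h : [x] <:+ iterW φ r [0]) : [nextLetter m p x] <:+ iterW φ (r + 1) [0] := by
  have h1 := iterW_suffix φ 1 h
  rw [iterW_one, H.subst_eq x hx, ← iterW_add, add_comm] at h1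
  exact (List.suffix_append _ _).trans h1

lemma letter_suffix_iterW (H : IsParryWord m p α φ u) {ℓ : ℕ} (hℓ : ℓ < m + p) :
    [ℓ] <:+ iterW φ ℓ [0] := by
  induction ℓ with
  | zero => exact List.suffix_rfl
  | succ ℓ ih =>
    have h1 := H.suffix_iterW_succ (by omega) (ih (by omega))
    rwa [nextLetter, if_pos hℓ] at h1

lemma periodic_letter_suffix_iterW (H : IsParryWord m p α φ u) (t : ℕ) {ℓ : ℕ} (hm : m ≤ ℓ)
    (hℓ : ℓ < m + p) : [ℓ] <:+ iterW φ (ℓ + p * t) [0] := by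
  have hp := H.one_le_p
  induction t generalizing ℓ with
  | zero => exact H.letter_suffix_iterW hℓ
  | succ t ih =>
    induction ℓ, hm using Nat.le_induction with
    | base =>
      have h1 := H.suffix_iterW_succ (by omega) (ih (ℓ := m + p - 1) (by omega) (by omega))
      rw [nextLetter, if_neg (by omega)] at h1
      convert h1 using 2
      rw [mul_add]
      omega
    | succ ℓ hmℓ ih2 =>
      have h1 := H.suffix_iterW_succ (by omega) (ih2 (by omega))
      rw [nextLetter, if_pos hℓ] at h1
      convert h1 using 2
      omega

lemma zero_prefix_subst (H : IsParryWord m p α φ u) {ℓ : ℕ} (hℓ : ℓ < m + p) (h : 1 ≤ α ℓ) :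
    [0] <+: φ ℓ := by
  obtain ⟨a, ha⟩ : ∃ a, α ℓ = a + 1 := ⟨α ℓ - 1, by omega⟩
  rw [H.subst_eq ℓ hℓ, ha]
  simp [List.replicate_succ]

lemma zero_prefix_iterW_of_le (H : IsParryWord m p α φ u) {h ℓ r : ℕ} (hh : h < m + p)
    (hαh : 1 ≤ α h) (hℓ : ℓ ≤ h) (hr : h + 1 ≤ ℓ + r) : [0] <+: iterW φ r [ℓ] := by
  induction r generalizing ℓ with
  | zero => omega
  | succ r ih =>
    rw [iterW_add, iterW_one]
    by_cases hα : 1 ≤ α ℓ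
    · exact (H.zero_prefix_iterW r).trans (iterW_prefix φ r (H.zero_prefix_subst (by omega) hα))
    · have hne : ℓ ≠ h := by rintro rfl; exact hα hαh
      rw [H.subst_eq ℓ (by omega), nextLetter, if_pos (by omega), show α ℓ = 0 by omega]
      exact ih (by omega) (by omega)

lemma isPref_iterW_append_zero (H : IsParryWord m p α φ u) {h r : ℕ} (hh : h < m + p)
    (hαh : 1 ≤ α h) (h1 : 1 ≤ h) (hr : 2 ≤ α 0 ∨ h ≤ r) : IsPref u (iterW φ r [0] ++ [0]) := by
  obtain ⟨y, t, ht, hy2, hy1⟩ := H.subst_zero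
  have hy : [0] <+: iterW φ r [y] := by
    by_cases hα : 2 ≤ α 0
    · rw [hy2 hα]
      exact H.zero_prefix_iterW r
    · rw [hy1 (by have := H.one_le_zero; omega)]
      exact H.zero_prefix_iterW_of_le hh hαh h1 (by omega)
  refine (H.isPref_iterW (r + 1)).of_prefix ?_
  rw [iterW_add, iterW_one, ht]
  refine List.IsPrefix.trans ?_ (iterW_prefix φ r (v := [0] ++ [y]) (by simp))
  rw [iterW_append]
  exact (List.prefix_append_right_inj _).2 hy

lemma isPref_iterW_append_pref (H : IsParryWord m p α φ u) {R n k : ℕ}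
    (hRp : IsPref u (iterW φ R [0] ++ [0])) (hk : n ≤ (iterW φ k [0]).length) :
    IsPref u (iterW φ (k + R) [0] ++ pref u n) := by
  refine (H.isPref_image hRp k).of_prefix ?_
  rw [iterW_append, iterW_add]
  exact (List.prefix_append_right_inj _).2
    ((isPref_pref u n).prefix_of_length_le (H.isPref_iterW k) (by rwa [length_pref]))

/-- Each block of `u` between two zeros reappears in `φ^R(0)0`. -/
lemma exists_suffix_infix (H : IsParryWord m p α φ u) {h R : ℕ} (hm : m ≤ h) (hh : h < m + p)
    (hαh : 1 ≤ α h) (hR : h + p ≤ R) (hR1 : α 0 = 1 → h + m + p - 1 ≤ R)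
    {A : List ℕ} (hA : A ≠ []) (hA0 : IsPref u (A ++ [0])) :
    ∃ B S, A = B ++ S ∧ [0] <+: S ∧ S ++ [0] <:+: iterW φ R [0] ++ [0] := by
  have h1 : 1 ≤ h := H.one_le_m.trans hm
  have hp := H.one_le_p
  have hα0 := H.one_le_zero
  have hRp := H.isPref_iterW_append_zero hh hαh h1 (r := R) (.inr (by omega))
  have key : ∀ r, r ≤ R → (2 ≤ α 0 ∨ h ≤ r) →
      iterW φ r [0] ++ [0] <+: iterW φ R [0] ++ [0] := fun r hr hr' =>
    (H.isPref_iterW_append_zero hh hαh h1 hr').prefix_of_length_le hRp (by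
      simpa using (H.iterW_zero_prefix hr).length_le)
  obtain ⟨r, B, hB, rfl⟩ := H.exists_ancestor hA (hA0.of_prefix (by simp))
  by_cases hrh : h < r
  · obtain ⟨t, i, hi0, hip, rfl⟩ : ∃ t i, 1 ≤ i ∧ i ≤ p ∧ r = i + (h + p * t) :=
      ⟨(r - h - 1) / p, (r - h - 1) % p + 1, by omega, Nat.mod_lt _ hp, by
        have := Nat.mod_add_div (r - h - 1) p
        omega⟩
    have hs : iterW φ i [h] <:+ iterW φ (i + (h + p * t)) (B ++ [0]) := by
      rw [iterW_append, iterW_add φ i _ [0]]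
      exact (iterW_suffix φ i (H.periodic_letter_suffix_iterW t hm hh)).trans
        (List.suffix_append _ _)
    obtain ⟨B', hB'⟩ := hs
    refine ⟨B', _, hB'.symm, H.zero_prefix_iterW_of_le hh hαh le_rfl (by omega), ?_⟩
    refine List.IsInfix.trans ?_ (key (i + h) (by omega) (.inr (by omega))).isInfix
    obtain ⟨C, hC⟩ := iterW_suffix φ i (H.letter_suffix_iterW hh)
    rw [iterW_add, ← hC]
    exact ⟨C, [], by simp⟩
  · refine ⟨iterW φ r B, iterW φ r [0], iterW_append .., H.zero_prefix_iterW r, ?_⟩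
    by_cases hr' : 2 ≤ α 0 ∨ h ≤ r
    · exact (key r (by omega) hr').isInfix
    · have hα1 : α 0 = 1 := by omega
      obtain ⟨z, hz⟩ : ∃ z, IsPref u (B ++ [0, z]) := by
        refine ⟨u (B ++ [0]).length, ?_⟩
        have h2 := isPref_pref u ((B ++ [0]).length + 1)
        rw [pref_add, ← hB] at h2
        simpa using h2
      obtain ⟨d, hd, hzd⟩ := H.exists_infix_subst hz
      have hφd : [0, z] = φ d := hzd.eq_of_length_le (by
        have := H.le_zero d hd
        simp [H.subst_eq d hd]
        omega)
      have hz0 : [0] <+: iterW φ r [z] := by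
        have hne := H.iterW_letter_ne_nil r (H.mem_lt hz (x := z) (by simp))
        have h2 := hA0.prefix_of_length_le (H.isPref_image hz r) (by
          have := List.length_pos_iff.2 hne
          rw [show B ++ [0, z] = (B ++ [0]) ++ [z] by simp, iterW_append φ r (B ++ [0])]
          simp only [List.length_append, List.length_singleton]
          omega)
        rw [show B ++ [0, z] = (B ++ [0]) ++ [z] by simp, iterW_append φ r (B ++ [0])] at h2
        exact (List.prefix_append_right_inj _).1 h2
      have h3 : iterW φ r [0] ++ [0] <+: iterW φ (r + 1) [d] := by
        rw [iterW_add, iterW_one, ← hφd, show [0, z] = [0] ++ [z] from rfl, iterW_append]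
        exact (List.prefix_append_right_inj _).2 hz0
      have h4 : iterW φ (r + 1) [d] <:+ iterW φ (r + 1 + d) [0] := by
        rw [iterW_add φ (r + 1)]
        exact iterW_suffix φ _ (H.letter_suffix_iterW hd)
      have h5 := H.iterW_zero_prefix (j := r + 1 + d) (k := R)
        (by have := hR1 hα1; omega)
      exact h3.isInfix.trans (h4.isInfix.trans (h5.isInfix.trans (List.prefix_append _ _).isInfix))

/-- Every factor of length at most `|φ^k(0)|` begins in the prefix `φ^{k+R}(0)`. -/
lemma factor_infix (H : IsParryWord m p α φ u) {h R : ℕ} (hm : m ≤ h) (hh : h < m + p)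
    (hαh : 1 ≤ α h) (hR : h + p ≤ R) (hR1 : α 0 = 1 → h + m + p - 1 ≤ R) {n k : ℕ}
    (hk : n ≤ (iterW φ k [0]).length) {w : List ℕ} (hw : IsFactor u w) (hwn : w.length = n) :
    w <:+: iterW φ (k + R) [0] ++ pref u n := by
  classical
  obtain ⟨i, hi⟩ := hw
  rw [hwn] at hi
  have hRp := H.isPref_iterW_append_zero hh hαh (H.one_le_m.trans hm) (r := R) (.inr (by omega))
  have hex : ∃ a, a ≠ 0 ∧ IsPref u (pref u a ++ [0]) ∧ i < (iterW φ k (pref u a)).length := by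
    have hq : (iterW φ (R + i) [0]).length ≠ 0 := by
      have := H.lt_length_iterW (R + i)
      omega
    refine ⟨_, hq, ?_, ?_⟩
    · rw [← H.isPref_iterW]
      exact H.isPref_iterW_append_zero hh hαh (H.one_le_m.trans hm) (.inr (by omega))
    · rw [← H.isPref_iterW, ← iterW_add]
      have := H.lt_length_iterW (k + (R + i))
      omega
  obtain ⟨ha0, ha, hai⟩ := Nat.find_spec hex
  have hmin := fun b (hb : b < Nat.find hex) => Nat.find_min hex hb
  generalize Nat.find hex = a at ha0 ha hai hmin
  obtain ⟨B, S, hBS, hS0, X, Y, hXY⟩ := H.exists_suffix_infix hm hh hαh hR hR1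
    (A := pref u a) (by simpa [← List.length_pos_iff, length_pref, Nat.pos_iff_ne_zero] using ha0) ha
  have hpa := isPref_pref u a
  have hpn : pref u n <+: iterW φ k [0] :=
    (isPref_pref u n).prefix_of_length_le (H.isPref_iterW k) (by rwa [length_pref])
  have hlen : B.length + S.length = a := by rw [← List.length_append, ← hBS, length_pref]
  have hSpos : 1 ≤ S.length := hS0.length_le
  have hBi : (iterW φ k B).length ≤ i := by
    by_contra! hcon
    have hBp : IsPref u (B ++ [0]) := by
      refine hpa.of_prefix ?_
      rw [hBS]
      exact (List.prefix_append_right_inj _).2 hS0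
    have hB0 : IsPref u B := hBp.of_prefix (by simp)
    refine hmin B.length (by omega) ⟨?_, ?_, ?_⟩
    · intro h0
      rw [List.length_eq_zero_iff.1 h0] at hcon
      have : iterW φ k [] = [] := by
        have := congrArg List.length (iterW_append φ k [] [])
        simpa using this
      simp [this] at hcon
    · rwa [← hB0]
    · rwa [← hB0]
  have hbig : IsPref u (iterW φ k B ++ (iterW φ k S ++ pref u n)) := by
    refine (H.isPref_image ha k).of_prefix ?_
    rw [iterW_append, hBS, iterW_append, List.append_assoc]
    simpa using hpn
  have hw1 : w <:+: iterW φ k S ++ pref u n := by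
    have h1 : pref u i ++ w = pref u (i + n) := by rw [pref_add, hi]
    have h2 : pref u i ++ w <+: iterW φ k B ++ (iterW φ k S ++ pref u n) := by
      rw [h1]
      refine (isPref_pref u _).prefix_of_length_le hbig ?_
      rw [hBS, iterW_append, List.length_append] at hai
      simp only [length_pref, List.length_append]
      omega
    obtain ⟨v, hv⟩ : iterW φ k B <+: pref u i :=
      (hbig.of_prefix (by simp)).prefix_of_length_le (isPref_pref u i) (by rwa [length_pref])
    rw [← hv, List.append_assoc, List.prefix_append_right_inj] at h2
    exact (List.suffix_append v w).isInfix.trans h2.isInfix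
  have hfin : iterW φ k (X ++ S) ++ pref u n <+: iterW φ (k + R) [0] ++ pref u n := by
    have hXS : X ++ S <+: iterW φ R [0] := by
      refine List.prefix_of_prefix_length_le (l₃ := iterW φ R [0] ++ [0])
        ⟨[0] ++ Y, by simpa using hXY⟩ (List.prefix_append _ _) ?_
      have := congrArg List.length hXY
      simp at this ⊢
      omega
    have hp1 : IsPref u (iterW φ k (X ++ S) ++ pref u n) := by
      refine (H.isPref_image hRp k).of_prefix ?_
      rw [← hXY, show X ++ (S ++ [0]) ++ Y = (X ++ S) ++ ([0] ++ Y) by simp,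
        iterW_append φ k (X ++ S), iterW_append φ k [0]]
      exact (List.prefix_append_right_inj _).2 (hpn.trans (List.prefix_append _ _))
    have hp2 := H.isPref_iterW_append_pref hRp hk
    refine hp1.prefix_of_length_le hp2 ?_
    have := (iterW_prefix φ k hXS).length_le
    rw [iterW_add]
    simp only [List.length_append] at this ⊢
    omega
  refine hw1.trans (List.IsInfix.trans ?_ hfin.isInfix)
  rw [iterW_append, List.append_assoc]
  exact (List.suffix_append _ _).isInfix

end IsParryWord

theorem stmt11
    (m p : ℕ) (hm : 1 ≤ m) (hp : 1 ≤ p) (α : ℕ → ℕ) (hα0 : 1 ≤ α 0)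
    (hαle : ∀ ℓ, ℓ < m + p → α ℓ ≤ α 0)
    (hαex : ∃ ℓ, m ≤ ℓ ∧ ℓ ≤ m + p - 1 ∧ 1 ≤ α ℓ)
    (φ : ℕ → List ℕ)
    (hφ : ∀ ℓ, ℓ + 1 < m + p → φ ℓ = List.replicate (α ℓ) 0 ++ [ℓ + 1])
    (hφlast : φ (m + p - 1) = List.replicate (α (m + p - 1)) 0 ++ [m])
    (u : ℕ → ℕ) (hu : ∀ i, u i < m + p)
    (hufix : ∀ k : ℕ, iterW φ k [0] = pref u (iterW φ k [0]).length)
    (h' : ℕ) (hh' : h' = sInf {ℓ : ℕ | m ≤ ℓ ∧ ℓ ≤ m + p - 1 ∧ 1 ≤ α ℓ})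
    (R : ℕ) (hR : R = if 2 ≤ α 0 then h' + p else h' + m + p - 1)
    (n k : ℕ) (hn : 1 ≤ n) (hk : n ≤ (iterW φ k [0]).length) :
    (iterW φ (k + R) [0] ++ pref u n) =
      pref u (iterW φ (k + R) [0] ++ pref u n).length ∧
    (∀ w : List ℕ, IsFactor u w → w.length = n →
      w <:+: (iterW φ (k + R) [0] ++ pref u n)) := by
  have hne : {ℓ : ℕ | m ≤ ℓ ∧ ℓ ≤ m + p - 1 ∧ 1 ≤ α ℓ}.Nonempty := hαex
  obtain ⟨hmh, hhp, hαh⟩ := hh' ▸ Nat.sInf_mem hne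
  have H : IsParryWord m p α φ u :=
    { one_le_m := hm
      one_le_p := hp
      one_le_zero := hα0
      le_zero := hαle
      subst_eq := fun ℓ hℓ => by
        by_cases h : ℓ + 1 < m + p
        · rw [hφ ℓ h, nextLetter, if_pos h]
        · obtain rfl : ℓ = m + p - 1 := by omega
          rw [hφlast, nextLetter, if_neg h]
      letter_lt := hu
      isPref_iterW := hufix }
  have hRle : h' + p ≤ R := by split_ifs at hR <;> omega
  have hR1 : α 0 = 1 → h' + m + p - 1 ≤ R := fun h => by
    rw [hR, if_neg (by omega)]
  have hRp := H.isPref_iterW_append_zero (h := h') (r := R) (by omega) hαh (by omega)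
    (.inr (by omega))
  exact ⟨H.isPref_iterW_append_pref hRp hk, fun w hw hwn =>
    H.factor_infix hmh (by omega) hαh hRle hR1 hk hw hwn⟩
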